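/- Let R be a standard graded reduced ring of dimension 1 over a perfect field of characteristic p > 0 and I a homogeneous ideal of finite colength generated by homogeneous elements of degrees d_1 ≤ … ≤ d_μ. Let m_0 ≥ 1 satisfy ℓ(R_m) = ℓ(R_{m+1}) for all m ≥ m_0, and set f_n(x) = ℓ(R/I^{[p^n]})_{⌊x p^n⌋}. Then for each x ≥ 0 outside the set T_n = (0, m_0/q] ∪ ⋃_i (d_i, d_i + m_0/q] (where q = p^n), one has f_n(x) = f_{n+l}(x) for all l ≥ 0; consequently f(x) = lim_{n→∞} f_n(x) exists for every x ∈ [0,∞). -/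

import Mathlib

open Filter Topology

/-- The `q`-th Frobenius power `I^{[q]}` of an ideal. -/
def frobeniusPower {R : Type*} [CommRing R] (I : Ideal R) (q : ℕ) : Ideal R :=
  Ideal.span ((fun x => x ^ q) '' (I : Set R))

/-- `ℓ(R/I^{[q]})_m`: the `k`-dimension of the degree-`m` graded piece of `R/I^{[q]}`,
realized as the image of `R_m = 𝒜 m` in the quotient. -/
noncomputable def ringGradedPieceLength {k R : Type*} [Field k] [CommRing R] [Algebra k R]
    (𝒜 : ℕ → Submodule k R) (I : Ideal R) (q m : ℕ) : ℕ :=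
  Module.finrank k ((𝒜 m).map (Ideal.Quotient.mkₐ k (frobeniusPower I q)).toLinearMap)

section FrobeniusDensity

variable {k R : Type*} [Field k] [CommRing R] [Algebra k R] (𝒜 : ℕ → Submodule k R)

/-- The degree-`N` piece `∑ i, h i * 𝒜 (N - e i)` (over those `i` with `e i ≤ N`) of the ideal
generated by homogeneous elements `h i` of degrees `e i`. -/
def gradedSpanPiece {ι : Type*} (h : ι → R) (e : ι → ℕ) (N : ℕ) : Submodule k R :=
  ⨆ i, ⨆ _ : e i ≤ N, (𝒜 (N - e i)).map (LinearMap.mulLeft k (h i))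

variable {𝒜}

theorem map_mulLeft_le [GradedAlgebra 𝒜] {a : R} {c m : ℕ} (ha : a ∈ 𝒜 c) :
    (𝒜 m).map (LinearMap.mulLeft k a) ≤ 𝒜 (m + c) := by
  rintro _ ⟨y, hy, rfl⟩
  rw [add_comm]
  exact SetLike.mul_mem_graded ha hy

theorem gradedSpanPiece_le [GradedAlgebra 𝒜] {ι : Type*} {h : ι → R} {e : ι → ℕ}
    (he : ∀ i, h i ∈ 𝒜 (e i)) (N : ℕ) : gradedSpanPiece 𝒜 h e N ≤ 𝒜 N := by
  refine iSup₂_le fun i hi => (map_mulLeft_le (he i)).trans ?_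
  rw [Nat.sub_add_cancel hi]

theorem inf_span_eq_gradedSpanPiece [GradedAlgebra 𝒜] {ι : Type*} {h : ι → R} {e : ι → ℕ}
    (he : ∀ i, h i ∈ 𝒜 (e i)) (N : ℕ) :
    𝒜 N ⊓ (Ideal.span (Set.range h)).restrictScalars k = gradedSpanPiece 𝒜 h e N := by
  apply le_antisymm
  · rintro x ⟨hxN, hx⟩
    have key : ∀ r : R, (DirectSum.decompose 𝒜 (r * x) N : R) ∈ gradedSpanPiece 𝒜 h e N := by
      replace hx : x ∈ Submodule.span R (Set.range h) := hx
      clear hxN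
      induction hx using Submodule.span_induction with
      | mem y hy =>
        obtain ⟨i, rfl⟩ := hy
        intro r
        by_cases hi : e i ≤ N
        · rw [DirectSum.coe_decompose_mul_of_right_mem_of_le 𝒜 (he i) hi]
          refine Submodule.mem_iSup_of_mem i (Submodule.mem_iSup_of_mem hi ?_)
          exact ⟨_, SetLike.coe_mem (DirectSum.decompose 𝒜 r (N - e i)), mul_comm _ _⟩
        · rw [DirectSum.coe_decompose_mul_of_right_mem_of_not_le 𝒜 (he i) hi]
          exact zero_mem _
      | zero => intro r; simp
      | add y z _ _ hy hz =>
        intro r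
        rw [mul_add, DirectSum.decompose_add, DirectSum.add_apply, Submodule.coe_add]
        exact add_mem (hy r) (hz r)
      | smul s y _ hy =>
        intro r
        rw [smul_eq_mul, ← mul_assoc]
        exact hy _
    have := key 1
    rwa [one_mul, DirectSum.decompose_of_mem_same 𝒜 hxN] at this
  · refine le_inf (gradedSpanPiece_le he N) (iSup₂_le fun i _ => ?_)
    rintro _ ⟨y, -, rfl⟩
    exact Ideal.mul_mem_right _ _ (Ideal.subset_span ⟨i, rfl⟩)

theorem finrank_map_add_finrank_inf_ker {V W : Type*} [AddCommGroup V] [Module k V]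
    [AddCommGroup W] [Module k W] (f : V →ₗ[k] W) (S : Submodule k V) [FiniteDimensional k S] :
    Module.finrank k (S.map f) + Module.finrank k ↥(S ⊓ LinearMap.ker f) =
      Module.finrank k S := by
  rw [← LinearMap.finrank_range_add_finrank_ker (f.domRestrict S), LinearMap.range_domRestrict,
    LinearMap.ker_domRestrict, ← Submodule.map_comap_subtype]
  congr 1
  exact Submodule.finrank_map_subtype_eq S _

theorem ringGradedPieceLength_add [GradedAlgebra 𝒜] [∀ m, FiniteDimensional k (𝒜 m)]
    (p : ℕ) [ExpChar R p] {ι : Type*} {g : ι → R} {d : ι → ℕ} (hd : ∀ i, g i ∈ 𝒜 (d i))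
    (n N : ℕ) :
    ringGradedPieceLength 𝒜 (Ideal.span (Set.range g)) (p ^ n) N +
      Module.finrank k (gradedSpanPiece 𝒜 (fun i => g i ^ p ^ n) (fun i => p ^ n * d i) N) =
      Module.finrank k (𝒜 N) := by
  have hfrob : frobeniusPower (Ideal.span (Set.range g)) (p ^ n) =
      Ideal.span (Set.range fun i => g i ^ p ^ n) := by
    have h1 : frobeniusPower (Ideal.span (Set.range g)) (p ^ n) =
      (Ideal.span (Set.range g)).map (iterateFrobenius R p n) := rfl
    rw [h1, Ideal.map_span, ← Set.range_comp]
    rfl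
  have hker : LinearMap.ker (Ideal.Quotient.mkₐ k
      (frobeniusPower (Ideal.span (Set.range g)) (p ^ n))).toLinearMap =
      (frobeniusPower (Ideal.span (Set.range g)) (p ^ n)).restrictScalars k := by
    ext x
    simp [Ideal.Quotient.eq_zero_iff_mem]
  unfold ringGradedPieceLength
  rw [← inf_span_eq_gradedSpanPiece, ← hfrob, ← hker]
  · exact finrank_map_add_finrank_inf_ker _ _
  · intro i
    simpa using SetLike.pow_mem_graded (p ^ n) (hd i)

theorem finrank_map_eq_of_semilinear {σ : k →+* k} [RingHomSurjective σ] {V W : Type*}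
    [AddCommGroup V] [Module k V] [AddCommGroup W] [Module k W] (f : V →ₛₗ[σ] W)
    (hf : Function.Injective f) (S : Submodule k V) :
    Module.finrank k (S.map f) = Module.finrank k S := by
  let g : S →ₛₗ[σ] S.map f := (f.domRestrict S).codRestrict (S.map f) fun x => ⟨x, x.2, rfl⟩
  have h := lift_rank_eq_of_equiv_equiv (R := k) (R' := k) (M := S) (M' := S.map f) σ
    (AddEquiv.ofBijective (g : S →+ S.map f)
      ⟨fun x y hxy => Subtype.ext (hf (congrArg Subtype.val hxy)),
        fun ⟨_, x, hx, e⟩ => ⟨⟨x, hx⟩, Subtype.ext e⟩⟩)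
    ⟨σ.injective, RingHomSurjective.is_surjective⟩
    (fun r m => g.map_smulₛₗ r m)
  have h' := congrArg Cardinal.toNat h
  simpa [Module.finrank] using h'.symm

/-- In a standard graded reduced Noetherian ring, all large degrees contain an element that is a
nonzerodivisor on the pieces of positive degree. -/
theorem exists_homogeneous_nonzerodivisor [IsNoetherianRing R] [IsReduced R] [GradedAlgebra 𝒜]
    (hstd : ∀ m : ℕ, (𝒜 (m + 1) : Set R) ⊆
      Submodule.span k (Set.image2 (· * ·) (𝒜 1 : Set R) (𝒜 m : Set R))) :
    ∃ E : ℕ, ∀ c, E ≤ c → ∃ a ∈ 𝒜 c, ∀ N, 1 ≤ N → ∀ y ∈ 𝒜 N, a * y = 0 → y = 0 := by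
  classical
  have hfin := minimalPrimes.finite_of_isNoetherianRing R
  set s : Finset (Ideal R) := hfin.toFinset.filter fun P => ¬ ∀ x ∈ 𝒜 1, x ∈ P with hs
  have hmin : ∀ P ∈ s, P ∈ minimalPrimes R := fun P hP => by
    simpa using (Finset.mem_filter.1 hP).1
  have hprime : ∀ P ∈ s, P.IsPrime := fun P hP => (hmin P hP).1.1
  have hhom : ∀ P ∈ s, P.IsHomogeneous 𝒜 := fun P hP => by
    have := hprime P hP
    have h1 := Ideal.toIdeal_homogeneousCore_le 𝒜 P
    have h2 : P ≤ (P.homogeneousCore 𝒜).toIdeal :=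
      (hmin P hP).2 ⟨Ideal.IsPrime.homogeneousCore this, bot_le⟩ h1
    rw [Ideal.IsHomogeneous.iff_eq]
    exact le_antisymm h1 h2
  have hx : ∀ P ∈ s, ∃ x ∈ 𝒜 1, x ∉ P := fun P hP => by
    simpa using (Finset.mem_filter.1 hP).2
  have hu : ∀ P ∈ s, ∃ (j : ℕ) (u : R), u ∈ 𝒜 j ∧ u ∉ P ∧ ∀ Q ∈ s, Q ≠ P → u ∈ Q := by
    intro P hP
    have hnot : ¬ (s.erase P).inf id ≤ P := by
      intro h
      obtain ⟨Q, hQ, hQP⟩ := (hprime P hP).inf_le'.1 h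
      have hQs := Finset.mem_of_mem_erase hQ
      exact Finset.ne_of_mem_erase hQ
        (le_antisymm hQP ((hmin P hP).2 ⟨hprime Q hQs, bot_le⟩ hQP))
    obtain ⟨v, hv, hvP⟩ := SetLike.not_le_iff_exists.1 hnot
    rw [(hhom P hP).mem_iff] at hvP
    push Not at hvP
    obtain ⟨j, hj⟩ := hvP
    refine ⟨j, _, SetLike.coe_mem _, hj, fun Q hQ hQP => ?_⟩
    have hvQ : v ∈ Q := (Finset.inf_le (f := id) (Finset.mem_erase.2 ⟨hQP, hQ⟩) : _ ≤ Q) hv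
    exact ((hhom Q hQ).mem_iff).1 hvQ j
  choose! x hx1 hxP using hx
  choose! j u huj huP huQ using hu
  refine ⟨s.sup j, fun c hc => ⟨∑ P ∈ s, x P ^ (c - j P) * u P, ?_, ?_⟩⟩
  · refine Submodule.sum_mem _ fun P hP => ?_
    have hle : j P ≤ c := (Finset.le_sup hP).trans hc
    have := SetLike.mul_mem_graded (SetLike.pow_mem_graded (c - j P) (hx1 P hP)) (huj P hP)
    simpa [Nat.sub_add_cancel hle] using this
  · intro N hN y hy hay
    have hall : ∀ P ∈ minimalPrimes R, y ∈ P := by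
      intro P hP
      by_cases hPs : P ∈ s
      · have hPp := hprime P hPs
        refine (hPp.mem_or_mem (hay ▸ P.zero_mem : _ * y ∈ P)).resolve_left fun hmem => ?_
        rw [← Finset.add_sum_erase _ _ hPs] at hmem
        have hrest : ∑ Q ∈ s.erase P, x Q ^ (c - j Q) * u Q ∈ P :=
          Submodule.sum_mem _ fun Q hQ => P.mul_mem_left _
            (huQ Q (Finset.mem_of_mem_erase hQ) P hPs (Finset.ne_of_mem_erase hQ).symm)
        rcases hPp.mem_or_mem ((P.add_mem_iff_left hrest).1 hmem) with h | h
        · exact hxP P hPs (hPp.mem_of_pow_mem _ h)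
        · exact huP P hPs h
      · have h1 : ∀ z ∈ 𝒜 1, z ∈ P := by
          by_contra hcon
          exact hPs (Finset.mem_filter.2 ⟨by simpa using hP, hcon⟩)
        obtain ⟨m, rfl⟩ := Nat.exists_eq_add_of_le' hN
        have hle : Submodule.span k (Set.image2 (· * ·) (𝒜 1 : Set R) (𝒜 m : Set R)) ≤
            P.restrictScalars k := by
          rw [Submodule.span_le]
          rintro _ ⟨z, hz, w, -, rfl⟩
          exact P.mul_mem_right _ (h1 z hz)
        exact hle (hstd m hy)
    have hy0 : y ∈ sInf (minimalPrimes R) := Submodule.mem_sInf.2 hall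
    rw [minimalPrimes, Ideal.sInf_minimalPrimes] at hy0
    have : IsNilpotent y := by simpa [nilradical] using hy0
    exact this.eq_zero

theorem finrank_eq_of_stable {m0 : ℕ}
    (hstab : ∀ m, m0 ≤ m → Module.finrank k (𝒜 m) = Module.finrank k (𝒜 (m + 1)))
    {m c : ℕ} (hm : m0 ≤ m) : Module.finrank k (𝒜 (m + c)) = Module.finrank k (𝒜 m) := by
  induction c with
  | zero => rfl
  | succ c ih => rw [← ih, hstab (m + c) (by omega)]; rfl

theorem finrank_map_mulLeft {a : R} {S : Submodule k R}
    (ha : ∀ y ∈ S, a * y = 0 → y = 0) :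
    Module.finrank k (S.map (LinearMap.mulLeft k a)) = Module.finrank k S := by
  have hinj : Function.Injective ((LinearMap.mulLeft k a).domRestrict S) := by
    rw [← LinearMap.ker_eq_bot, LinearMap.ker_eq_bot']
    rintro ⟨y, hy⟩ h
    exact Subtype.ext (ha y hy h)
  rw [← LinearMap.range_domRestrict]
  exact LinearMap.finrank_range_of_inj hinj

section Stable

variable [GradedAlgebra 𝒜] [∀ m, FiniteDimensional k (𝒜 m)] {m0 : ℕ}

theorem finrank_gradedSpanPiece_add_degree (hm0 : 1 ≤ m0)
    (hstab : ∀ m, m0 ≤ m → Module.finrank k (𝒜 m) = Module.finrank k (𝒜 (m + 1)))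
    {a : R} {c : ℕ} (hac : a ∈ 𝒜 c)
    (ha : ∀ N, 1 ≤ N → ∀ y ∈ 𝒜 N, a * y = 0 → y = 0)
    {ι : Type*} {h : ι → R} {e : ι → ℕ} (he : ∀ i, h i ∈ 𝒜 (e i)) {N : ℕ} (hN : m0 ≤ N)
    (hNe : ∀ i, e i + m0 ≤ N) :
    Module.finrank k (gradedSpanPiece 𝒜 h e (N + c)) =
      Module.finrank k (gradedSpanPiece 𝒜 h e N) := by
  have hmap : ∀ m, m0 ≤ m → (𝒜 m).map (LinearMap.mulLeft k a) = 𝒜 (m + c) := fun m hm =>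
    Submodule.eq_of_le_of_finrank_eq (map_mulLeft_le hac) <| by
      rw [finrank_map_mulLeft (ha m (hm0.trans hm)), finrank_eq_of_stable hstab hm]
  have heq : gradedSpanPiece 𝒜 h e (N + c) =
      (gradedSpanPiece 𝒜 h e N).map (LinearMap.mulLeft k a) := by
    simp only [gradedSpanPiece, Submodule.map_iSup]
    refine iSup_congr fun i => ?_
    have hi := hNe i
    rw [iSup_pos (by omega), iSup_pos (by omega), ← Submodule.map_comp,
      show N + c - e i = N - e i + c by omega, ← hmap (N - e i) (by omega), ← Submodule.map_comp]
    congr 1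
    ext y
    simp [mul_left_comm]
  rw [heq]
  exact finrank_map_mulLeft fun y hy => ha N (hm0.trans hN) y (gradedSpanPiece_le he N hy)

theorem finrank_gradedSpanPiece_add (hm0 : 1 ≤ m0)
    (hstab : ∀ m, m0 ≤ m → Module.finrank k (𝒜 m) = Module.finrank k (𝒜 (m + 1)))
    (hnzd : ∃ E : ℕ, ∀ c, E ≤ c → ∃ a ∈ 𝒜 c, ∀ N, 1 ≤ N → ∀ y ∈ 𝒜 N, a * y = 0 → y = 0)
    {ι : Type*} {h : ι → R} {e : ι → ℕ} (he : ∀ i, h i ∈ 𝒜 (e i)) {N c : ℕ} (hN : m0 ≤ N)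
    (hNe : ∀ i, e i + m0 ≤ N ∨ N + c < e i) :
    Module.finrank k (gradedSpanPiece 𝒜 h e (N + c)) =
      Module.finrank k (gradedSpanPiece 𝒜 h e N) := by
  obtain ⟨E, hE⟩ := hnzd
  have hred : ∀ M, N ≤ M → M ≤ N + c → gradedSpanPiece 𝒜 h e M =
      gradedSpanPiece 𝒜 (fun i : {i // e i + m0 ≤ N} => h i) (fun i => e i) M := by
    intro M hNM hM
    refine le_antisymm (iSup₂_le fun i hi => ?_) (iSup₂_le fun i hi => ?_)
    · have hi' : e i + m0 ≤ N := (hNe i).resolve_right (by omega)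
      exact le_iSup₂_of_le (⟨i, hi'⟩ : {i // e i + m0 ≤ N}) hi le_rfl
    · exact le_iSup₂_of_le i.1 hi le_rfl
  rw [hred N le_rfl (by omega), hred (N + c) (by omega) le_rfl]
  obtain ⟨a, hac, ha⟩ := hE (c + E) (by omega)
  obtain ⟨b, hbc, hb⟩ := hE E le_rfl
  have h1 := finrank_gradedSpanPiece_add_degree hm0 hstab hac ha
    (h := fun i : {i // e i + m0 ≤ N} => h i) (fun i => he i) hN (fun i => i.2)
  have h2 := finrank_gradedSpanPiece_add_degree hm0 hstab hbc hb
    (h := fun i : {i // e i + m0 ≤ N} => h i) (fun i => he i) (N := N + c) (by omega)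
    (fun i => i.2.trans (by omega))
  rw [← h2, add_assoc, h1]

theorem finrank_gradedSpanPiece_frobenius [IsReduced R] (p : ℕ) [ExpChar k p] [ExpChar R p]
    [PerfectRing k p]
    (hstab : ∀ m, m0 ≤ m → Module.finrank k (𝒜 m) = Module.finrank k (𝒜 (m + 1)))
    {ι : Type*} {h : ι → R} {e : ι → ℕ} {N : ℕ}
    (hNe : ∀ i, e i ≤ N → e i = N ∨ e i + m0 ≤ N) :
    Module.finrank k (gradedSpanPiece 𝒜 (fun i => h i ^ p) (fun i => p * e i) (p * N)) =
      Module.finrank k (gradedSpanPiece 𝒜 h e N) := by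
  have hp : 0 < p := expChar_pos R p
  have : RingHomSurjective (frobenius k p) := ⟨(PerfectRing.bijective_frobenius (p := p)).2⟩
  have hinj : Function.Injective (LinearMap.frobenius k R p) := frobenius_inj R p
  have hmap : ∀ m, (m = 0 ∨ m0 ≤ m) →
      (𝒜 m).map (LinearMap.frobenius k R p) = 𝒜 (p * m) := by
    intro m hm
    refine Submodule.eq_of_le_of_finrank_eq ?_ ?_
    · rintro _ ⟨y, hy, rfl⟩
      simpa [LinearMap.frobenius_def] using SetLike.pow_mem_graded p hy
    · rw [finrank_map_eq_of_semilinear _ hinj]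
      rcases hm with rfl | hm
      · simp
      · obtain ⟨c, hc⟩ := Nat.exists_eq_add_of_le (Nat.le_mul_of_pos_left m hp)
        rw [hc, finrank_eq_of_stable hstab hm]
  have heq : gradedSpanPiece 𝒜 (fun i => h i ^ p) (fun i => p * e i) (p * N) =
      (gradedSpanPiece 𝒜 h e N).map (LinearMap.frobenius k R p) := by
    simp only [gradedSpanPiece, Submodule.map_iSup]
    refine iSup_congr fun i => iSup_congr_Prop (Nat.mul_le_mul_left_iff hp) fun hi => ?_
    have := hNe i hi
    rw [← Nat.mul_sub, ← hmap (N - e i) (by omega)]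
    ext y
    simp [LinearMap.frobenius_def, mul_pow]
  rw [heq, finrank_map_eq_of_semilinear _ hinj]

theorem ringGradedPieceLength_succ [IsReduced R] (p : ℕ) [ExpChar k p] [ExpChar R p]
    [PerfectRing k p] (hm0 : 1 ≤ m0)
    (hstab : ∀ m, m0 ≤ m → Module.finrank k (𝒜 m) = Module.finrank k (𝒜 (m + 1)))
    (hnzd : ∃ E : ℕ, ∀ c, E ≤ c → ∃ a ∈ 𝒜 c, ∀ N, 1 ≤ N → ∀ y ∈ 𝒜 N, a * y = 0 → y = 0)
    {ι : Type*} {g : ι → R} {d : ι → ℕ} (hd : ∀ i, g i ∈ 𝒜 (d i)) (n : ℕ) {N c : ℕ}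
    (hN : N = 0 ∧ c = 0 ∨ m0 ≤ N)
    (hNd : ∀ i, p ^ n * d i + m0 ≤ N ∨ (p ^ n * d i = N ∧ c = 0) ∨
      (N < p ^ n * d i ∧ p * N + c < p ^ (n + 1) * d i)) :
    ringGradedPieceLength 𝒜 (Ideal.span (Set.range g)) (p ^ (n + 1)) (p * N + c) =
      ringGradedPieceLength 𝒜 (Ideal.span (Set.range g)) (p ^ n) N := by
  have hp : 0 < p := expChar_pos R p
  have h1 := ringGradedPieceLength_add p hd n N
  have h2 := ringGradedPieceLength_add p hd (n + 1) (p * N + c)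
  have h3 : Module.finrank k (gradedSpanPiece 𝒜 (fun i => g i ^ p ^ (n + 1))
        (fun i => p ^ (n + 1) * d i) (p * N)) =
      Module.finrank k (gradedSpanPiece 𝒜 (fun i => g i ^ p ^ n) (fun i => p ^ n * d i) N) := by
    have hpow : (fun i => g i ^ p ^ (n + 1)) = fun i => (g i ^ p ^ n) ^ p := by
      simp only [pow_succ, pow_mul]
    have hdeg : (fun i => p ^ (n + 1) * d i) = fun i => p * (p ^ n * d i) := by
      simp only [pow_succ', mul_assoc]
    rw [hpow, hdeg]
    exact finrank_gradedSpanPiece_frobenius (m0 := m0) p hstab fun i hi => by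
      have := hNd i
      omega
  have hle : N ≤ p * N := Nat.le_mul_of_pos_left N hp
  have h4 : Module.finrank k (𝒜 (p * N + c)) = Module.finrank k (𝒜 N) := by
    rcases hN with ⟨rfl, rfl⟩ | hN
    · simp
    · obtain ⟨b, hb⟩ := Nat.exists_eq_add_of_le hle
      rw [hb, add_assoc, finrank_eq_of_stable hstab hN]
  have h5 : Module.finrank k (gradedSpanPiece 𝒜 (fun i => g i ^ p ^ (n + 1))
        (fun i => p ^ (n + 1) * d i) (p * N + c)) =
      Module.finrank k (gradedSpanPiece 𝒜 (fun i => g i ^ p ^ (n + 1))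
        (fun i => p ^ (n + 1) * d i) (p * N)) := by
    rcases Nat.eq_zero_or_pos c with rfl | hc
    · rfl
    · refine finrank_gradedSpanPiece_add hm0 hstab hnzd (fun i => ?_) (by omega) fun i => ?_
      · simpa using SetLike.pow_mem_graded (p ^ (n + 1)) (hd i)
      · rcases hNd i with h | h | h
        · left
          have := Nat.mul_le_mul_left p h
          have := Nat.le_mul_of_pos_left m0 hp
          rw [pow_succ', mul_assoc]
          linarith [mul_add p (p ^ n * d i) m0]
        · omega
        · exact Or.inr h.2
  omega

end Stable

theorem mul_floor_le_floor_mul {p : ℕ} {y : ℝ} (hy : 0 ≤ y) :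
    p * ⌊y⌋₊ ≤ ⌊p * y⌋₊ := by
  refine Nat.le_floor ?_
  push_cast
  exact mul_le_mul_of_nonneg_left (Nat.floor_le hy) (by positivity)

end FrobeniusDensity

/-- Dimension-one stabilization: for a standard graded reduced ring `R` of dimension `1`
over a perfect field of characteristic `p`, with `I` generated by homogeneous elements of
degrees `d_1 ≤ … ≤ d_μ`, `m_0 ≥ 1` with `ℓ(R_m) = ℓ(R_{m+1})` for `m ≥ m_0`, and
`f_n(x) = ℓ(R/I^{[p^n]})_{⌊x p^n⌋}`: for every `x ≥ 0` outside
`T_n = (0, m_0/q] ∪ ⋃_i (d_i, d_i + m_0/q]` (`q = p^n`) one has `f_n(x) = f_{n+l}(x)` for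
all `l ≥ 0`; consequently `f(x) = lim_n f_n(x)` exists for every `x ∈ [0, ∞)`. -/
theorem stmt5
    (k : Type*) [Field k] (p : ℕ) (hp : p.Prime) [CharP k p] [ExpChar k p] [PerfectRing k p]
    (R : Type*) [CommRing R] [IsNoetherianRing R] [Algebra k R] [IsReduced R]
    (𝒜 : ℕ → Submodule k R) [GradedAlgebra 𝒜]
    [∀ m, FiniteDimensional k (𝒜 m)]
    (hstd : ∀ m : ℕ, (𝒜 (m + 1) : Set R) ⊆
      Submodule.span k (Set.image2 (· * ·) (𝒜 1 : Set R) (𝒜 m : Set R)))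
    (hdim : ringKrullDim R = 1)
    (I : Ideal R) [Module.Finite k (R ⧸ I)]
    (μ : ℕ) (gens : Fin μ → R) (deg : Fin μ → ℕ)
    (hdeg : ∀ i, gens i ∈ 𝒜 (deg i)) (hdegpos : ∀ i, 0 < deg i)
    (hmono : Monotone deg)
    (hgen : I = Ideal.span (Set.range gens))
    (m0 : ℕ) (hm0 : 1 ≤ m0)
    (hstab : ∀ m, m0 ≤ m → Module.finrank k (𝒜 m) = Module.finrank k (𝒜 (m + 1))) :
    (∀ n : ℕ, ∀ x : ℝ, 0 ≤ x →
      x ∉ (Set.Ioc (0 : ℝ) ((m0 : ℝ) / (p : ℝ) ^ n) ∪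
        ⋃ i : Fin μ, Set.Ioc (deg i : ℝ) ((deg i : ℝ) + (m0 : ℝ) / (p : ℝ) ^ n)) →
      ∀ l : ℕ,
        ringGradedPieceLength 𝒜 I (p ^ n) (Nat.floor (x * (p : ℝ) ^ n)) =
          ringGradedPieceLength 𝒜 I (p ^ (n + l)) (Nat.floor (x * (p : ℝ) ^ (n + l)))) ∧
    (∀ x : ℝ, 0 ≤ x → ∃ L : ℝ, Tendsto
      (fun n : ℕ => (ringGradedPieceLength 𝒜 I (p ^ n) (Nat.floor (x * (p : ℝ) ^ n)) : ℝ))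
      atTop (nhds L)) := by
  have : Nontrivial R := by
    by_contra hR
    rw [not_nontrivial_iff_subsingleton] at hR
    rw [ringKrullDim_eq_bot_of_subsingleton] at hdim
    exact absurd hdim (by decide)
  have : CharP R p := charP_of_injective_algebraMap (algebraMap k R).injective p
  have : ExpChar R p := ExpChar.prime hp
  have hnzd := exists_homogeneous_nonzerodivisor hstd
  have hp0 : (0 : ℝ) < p := by exact_mod_cast hp.pos
  have hp1 : (1 : ℝ) ≤ p := by exact_mod_cast hp.one_le
  subst hgen
  have main : ∀ n : ℕ, ∀ x : ℝ, 0 ≤ x →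
      x ∉ (Set.Ioc (0 : ℝ) ((m0 : ℝ) / (p : ℝ) ^ n) ∪
        ⋃ i : Fin μ, Set.Ioc (deg i : ℝ) ((deg i : ℝ) + (m0 : ℝ) / (p : ℝ) ^ n)) →
      ∀ l : ℕ,
        ringGradedPieceLength 𝒜 (Ideal.span (Set.range gens)) (p ^ n)
            (Nat.floor (x * (p : ℝ) ^ n)) =
          ringGradedPieceLength 𝒜 (Ideal.span (Set.range gens)) (p ^ (n + l))
            (Nat.floor (x * (p : ℝ) ^ (n + l))) := by
    intro n x hx hxT l
    simp only [Set.mem_union, Set.mem_iUnion, Set.mem_Ioc, not_or, not_exists, not_and,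
      not_le] at hxT
    obtain ⟨hx0, hxd⟩ := hxT
    induction l with
    | zero => rfl
    | succ l ih =>
      rw [ih, ← add_assoc]
      have hmono' : (m0 : ℝ) / (p : ℝ) ^ (n + l) ≤ (m0 : ℝ) / (p : ℝ) ^ n := by
        gcongr
        exact n.le_add_right l
      generalize n + l = r at *
      have hq : (0 : ℝ) < (p : ℝ) ^ r := by positivity
      have hxq : 0 ≤ x * (p : ℝ) ^ r := by positivity
      have hsucc : x * (p : ℝ) ^ (r + 1) = p * (x * (p : ℝ) ^ r) := by ring
      obtain ⟨c, hc⟩ := Nat.exists_eq_add_of_le (mul_floor_le_floor_mul (p := p) hxq)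
      rw [hsucc, hc]
      refine (ringGradedPieceLength_succ p hm0 hstab hnzd hdeg r ?_ fun i => ?_).symm
      · rcases hx.eq_or_lt with rfl | hpos
        · left
          simp at hc ⊢
          exact hc.symm
        · right
          refine Nat.le_floor ?_
          have := hmono'.trans_lt (hx0 hpos)
          rw [div_lt_iff₀ hq] at this
          exact this.le
      · rcases lt_trichotomy x (deg i) with h | h | h
        · right; right
          rw [← hc]
          constructor
          · rw [Nat.floor_lt hxq]
            push_cast
            nlinarith
          · rw [Nat.floor_lt (by positivity)]
            push_cast
            rw [pow_succ]
            have := mul_lt_mul_of_pos_right h (mul_pos hp0 hq)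
            linarith
        · right; left
          have hfl : ∀ s : ℕ, ⌊x * (p : ℝ) ^ s⌋₊ = p ^ s * deg i := fun s => by
            rw [h, mul_comm]
            exact_mod_cast Nat.floor_natCast (R := ℝ) (p ^ s * deg i)
          rw [← hsucc, hfl, hfl, pow_succ', mul_assoc] at hc
          exact ⟨(hfl r).symm, by omega⟩
        · left
          refine Nat.le_floor ?_
          have := (add_le_add_right hmono' _).trans_lt (hxd i h)
          have h2 := mul_lt_mul_of_pos_right this hq
          rw [add_mul, div_mul_cancel₀ _ hq.ne'] at h2
          push_cast
          linarith
  refine ⟨main, fun x hx => ?_⟩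
  have hlim : Tendsto (fun n : ℕ => (m0 : ℝ) / (p : ℝ) ^ n) atTop (nhds 0) :=
    tendsto_const_nhds.div_atTop
      (tendsto_pow_atTop_atTop_of_one_lt (by exact_mod_cast hp.one_lt))
  have hev : ∀ t : ℝ, ∀ᶠ n : ℕ in atTop, t < x → t + (m0 : ℝ) / (p : ℝ) ^ n < x := by
    intro t
    by_cases ht : t < x
    · filter_upwards [hlim.eventually_lt_const (sub_pos.2 ht)] with n hn _
      linarith
    · exact Eventually.of_forall fun n h => absurd h ht
  obtain ⟨n, hn0, hnd⟩ :=
    ((hev 0).and (eventually_all.2 fun i : Fin μ => hev (deg i))).exists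
  refine ⟨(ringGradedPieceLength 𝒜 (Ideal.span (Set.range gens)) (p ^ n)
    ⌊x * (p : ℝ) ^ n⌋₊ : ℝ), tendsto_atTop_of_eventually_const (i₀ := n) fun j hj => ?_⟩
  obtain ⟨l, rfl⟩ := Nat.exists_eq_add_of_le hj
  rw [← main n x hx ?_ l]
  rw [zero_add] at hn0
  simpa [not_or] using ⟨hn0, hnd⟩
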